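/- For p = 1, 2, …, let ν_{K^{(p)}} and ν_{R^{(p)}} be probability measures on [0,∞) whose second moments are bounded uniformly in p, converging weakly to probability measures ν_K and ν_R on [0,∞) that also have finite second moments, with ν_R not concentrated at zero and ν_K not concentrated at zero. Let (h^{(p)}, k^{(p)}) be the solutions, in the class of pairs with h analytic on ℂ∖[0,∞), continuous and positive on the open negative semi-axis, Im h(z)·Im z > 0 for Im z ≠ 0 and sup_{ξ≥1} ξ h(−ξ) ∈ (0,∞), of the system h(z) = ∫ λ ν_{R^{(p)}}(dλ)/(k(z)λ − z), k(z) = ∫ λ ν_{K^{(p)}}(dλ)/(h(z)λ + 1). Then (h^{(p)}, k^{(p)}) converges pointwise on ℂ∖[0,∞) to the solution (h, k), in the same class, of the system with the limiting measures ν_K and ν_R. -/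

import Mathlib

open MeasureTheory Matrix Filter Topology ENNReal

noncomputable section

/-- The cut plane `ℂ ∖ [0,∞)`. -/
def cutPlane : Set ℂ := {z : ℂ | ¬ (z.im = 0 ∧ 0 ≤ z.re)}

/-- The admissibility class for the function `h`: analytic on `ℂ∖[0,∞)`, continuous and
positive on the open negative semi-axis, `Im h(z)·Im z > 0` off the real axis, and
`sup_{ξ≥1} ξ h(−ξ) ∈ (0,∞)`. -/
def AdmissibleH (h : ℂ → ℂ) : Prop :=
  DifferentiableOn ℂ h cutPlane ∧
  ContinuousOn h {z : ℂ | z.im = 0 ∧ z.re < 0} ∧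
  (∀ x : ℝ, x < 0 → (h (x : ℂ)).im = 0 ∧ 0 < (h (x : ℂ)).re) ∧
  (∀ z : ℂ, z.im ≠ 0 → 0 < (h z).im * z.im) ∧
  (∃ c : ℝ, 0 < c ∧ ∀ ξ : ℝ, 1 ≤ ξ → ξ * (h (-(ξ : ℂ))).re ≤ c)

/-- The pair `(h,k)` solves the system
`h(z) = ∫ λ ν_R(dλ)/(k(z)λ − z)`, `k(z) = ∫ λ ν_K(dλ)/(h(z)λ + 1)` on `ℂ∖[0,∞)`. -/
def SolvesSystem (h k : ℂ → ℂ) (νR νK : Measure ℝ) : Prop :=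
  ∀ z ∈ cutPlane,
    h z = (∫ x : ℝ, (x : ℂ) / (k z * (x : ℂ) - z) ∂νR) ∧
    k z = (∫ x : ℝ, (x : ℂ) / (h z * (x : ℂ) + 1) ∂νK)

/-- Weak convergence of a sequence of measures on ℝ. -/
def WeakLim (μ : ℕ → Measure ℝ) (ν : Measure ℝ) : Prop :=
  ∀ f : BoundedContinuousFunction ℝ ℝ,
    Tendsto (fun n => ∫ x, f x ∂(μ n)) atTop (𝓝 (∫ x, f x ∂ν))

/-- The transform `∫ x/(a x + b)`. -/
def TT (a b : ℂ) (μ : Measure ℝ) : ℂ := ∫ x : ℝ, (x : ℂ) / (a * (x : ℂ) + b) ∂μ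
def QQ (a b : ℂ) (μ : Measure ℝ) : ℝ := ∫ x : ℝ, (x / ‖a * (x : ℂ) + b‖) ^ 2 ∂μ
def PP (a b : ℂ) (μ : Measure ℝ) : ℝ := ∫ x : ℝ, x / ‖a * (x : ℂ) + b‖ ^ 2 ∂μ

/-- denominators bounded below -/
def LB (c : ℝ) (a b : ℂ) : Prop := ∀ x : ℝ, 0 ≤ x → c ≤ ‖a * (x : ℂ) + b‖

theorem ae_nonneg_of {μ : Measure ℝ} (h : μ (Set.Iio 0) = 0) : ∀ᵐ x ∂μ, (0 : ℝ) ≤ x := by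
  rw [ae_iff]
  convert h using 2
  ext x; simp

theorem int_id {μ : Measure ℝ} [IsProbabilityMeasure μ]
    (h2 : Integrable (fun x : ℝ => x ^ 2) μ) : Integrable (fun x : ℝ => x) μ := by
  have : Integrable (fun x : ℝ => 1 + x ^ 2) μ := (integrable_const _).add h2
  refine this.mono' (by fun_prop) (ae_of_all _ fun x => ?_)
  rw [Real.norm_eq_abs, abs_le]
  constructor <;> nlinarith [sq_nonneg (x - 1), sq_nonneg (x + 1)]

theorem int_Q {μ : Measure ℝ} (h0 : μ (Set.Iio 0) = 0)
    (h2 : Integrable (fun x : ℝ => x ^ 2) μ) {a b : ℂ} {c : ℝ} (hc : 0 < c) (hl : LB c a b) :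
    Integrable (fun x : ℝ => (x / ‖a * (x : ℂ) + b‖) ^ 2) μ := by
  refine (h2.div_const (c ^ 2)).mono' (Measurable.aestronglyMeasurable (by fun_prop)) ?_
  filter_upwards [ae_nonneg_of h0] with x hx
  have := hl x hx
  rw [Real.norm_eq_abs, abs_of_nonneg (by positivity), div_pow]
  gcongr

theorem int_P {μ : Measure ℝ} [IsProbabilityMeasure μ] (h0 : μ (Set.Iio 0) = 0)
    (h2 : Integrable (fun x : ℝ => x ^ 2) μ) {a b : ℂ} {c : ℝ} (hc : 0 < c) (hl : LB c a b) :
    Integrable (fun x : ℝ => x / ‖a * (x : ℂ) + b‖ ^ 2) μ := by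
  refine ((int_id h2).div_const (c ^ 2)).mono' (Measurable.aestronglyMeasurable (by fun_prop)) ?_
  filter_upwards [ae_nonneg_of h0] with x hx
  have := hl x hx
  rw [Real.norm_eq_abs, abs_of_nonneg (by positivity)]
  gcongr

theorem int_N {μ : Measure ℝ} [IsProbabilityMeasure μ] (h0 : μ (Set.Iio 0) = 0)
    (h2 : Integrable (fun x : ℝ => x ^ 2) μ) {a b : ℂ} {c : ℝ} (hc : 0 < c) (hl : LB c a b) :
    Integrable (fun x : ℝ => x / ‖a * (x : ℂ) + b‖) μ := by
  refine ((int_id h2).div_const c).mono' (Measurable.aestronglyMeasurable (by fun_prop)) ?_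
  filter_upwards [ae_nonneg_of h0] with x hx
  have := hl x hx
  rw [Real.norm_eq_abs, abs_of_nonneg (by positivity)]
  gcongr

theorem int_T {μ : Measure ℝ} [IsProbabilityMeasure μ] (h0 : μ (Set.Iio 0) = 0)
    (h2 : Integrable (fun x : ℝ => x ^ 2) μ) {a b : ℂ} {c : ℝ} (hc : 0 < c) (hl : LB c a b) :
    Integrable (fun x : ℝ => (x : ℂ) / (a * (x : ℂ) + b)) μ := by
  refine (int_N h0 h2 hc hl).mono' (Measurable.aestronglyMeasurable (by fun_prop)) ?_
  filter_upwards [ae_nonneg_of h0] with x hx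
  rw [norm_div, Complex.norm_real, Real.norm_eq_abs, abs_of_nonneg hx]

theorem cs_sq {μ : Measure ℝ} {u v : ℝ → ℝ} (hu : Integrable (fun x => u x ^ 2) μ)
    (hv : Integrable (fun x => v x ^ 2) μ) (huv : Integrable (fun x => u x * v x) μ) :
    (∫ x, u x * v x ∂μ) ^ 2 ≤ (∫ x, u x ^ 2 ∂μ) * (∫ x, v x ^ 2 ∂μ) := by
  have key : ∀ t : ℝ, 0 ≤ (∫ x, u x ^ 2 ∂μ) * (t * t) + (2 * ∫ x, u x * v x ∂μ) * t
      + ∫ x, v x ^ 2 ∂μ := by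
    intro t
    have h1 : 0 ≤ ∫ x, (u x * t + v x) ^ 2 ∂μ := integral_nonneg fun x => sq_nonneg _
    have h2 : ∫ x, (u x * t + v x) ^ 2 ∂μ
        = ∫ x, (u x ^ 2 * (t * t) + u x * v x * (2 * t)) + v x ^ 2 ∂μ := by
      congr 1; ext x; ring
    have h3 : Integrable (fun x => u x ^ 2 * (t * t) + u x * v x * (2 * t)) μ :=
      (hu.mul_const _).add (huv.mul_const _)
    rw [h2, integral_add h3 hv,
      integral_add (hu.mul_const _) (huv.mul_const _), integral_mul_const,
      integral_mul_const] at h1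
    linarith
  have := discrim_le_zero key
  unfold discrim at this
  nlinarith

theorem QQ_nonneg (a b : ℂ) (μ : Measure ℝ) : 0 ≤ QQ a b μ :=
  integral_nonneg fun x => sq_nonneg _

theorem PP_nonneg (a b : ℂ) {μ : Measure ℝ} (h0 : μ (Set.Iio 0) = 0) : 0 ≤ PP a b μ := by
  refine integral_nonneg_of_ae ?_
  filter_upwards [ae_nonneg_of h0] with x hx
  simp only [Pi.zero_apply]
  positivity

theorem PP_pos {μ : Measure ℝ} [IsProbabilityMeasure μ] (h0 : μ (Set.Iio 0) = 0)
    (h2 : Integrable (fun x : ℝ => x ^ 2) μ) {a b : ℂ} {c : ℝ} (hc : 0 < c) (hl : LB c a b)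
    (hz : μ {0} < 1) : 0 < PP a b μ := by
  refine lt_of_le_of_ne (PP_nonneg a b h0) fun he => ?_
  have hnn : 0 ≤ᵐ[μ] fun x : ℝ => x / ‖a * (x : ℂ) + b‖ ^ 2 := by
    filter_upwards [ae_nonneg_of h0] with x hx
    simp only [Pi.zero_apply]
    positivity
  have h3 := (integral_eq_zero_iff_of_nonneg_ae hnn (int_P h0 h2 hc hl)).1 he.symm
  have h4 : ∀ᵐ x ∂μ, x ∈ ({0} : Set ℝ) := by
    filter_upwards [h3, ae_nonneg_of h0] with x hx hx0
    have := hl x hx0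
    have hx' : x / ‖a * (x : ℂ) + b‖ ^ 2 = 0 := hx
    rcases div_eq_zero_iff.1 hx' with hx | hx
    · simpa using hx
    · have : 0 < ‖a * (x : ℂ) + b‖ ^ 2 := by
        have : 0 < ‖a * (x : ℂ) + b‖ := by linarith
        positivity
      linarith
  have := prob_compl_eq_zero_iff (μ := μ) (measurableSet_singleton (0 : ℝ)) |>.1 h4
  exact absurd this hz.ne

theorem QQ_le {μ : Measure ℝ} (h0 : μ (Set.Iio 0) = 0)
    (h2 : Integrable (fun x : ℝ => x ^ 2) μ) {a b : ℂ} {c B : ℝ} (hc : 0 < c) (hl : LB c a b)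
    (hB : ∫ x, x ^ 2 ∂μ ≤ B) : QQ a b μ ≤ B / c ^ 2 := by
  calc QQ a b μ ≤ ∫ x, x ^ 2 / c ^ 2 ∂μ := by
        refine integral_mono_ae (int_Q h0 h2 hc hl) (h2.div_const _) ?_
        filter_upwards [ae_nonneg_of h0] with x hx
        have := hl x hx
        simp only [div_pow]
        gcongr
    _ = (∫ x, x ^ 2 ∂μ) / c ^ 2 := integral_div _ _
    _ ≤ _ := by gcongr

theorem TT_eq {μ : Measure ℝ} [IsProbabilityMeasure μ] (h0 : μ (Set.Iio 0) = 0)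
    (h2 : Integrable (fun x : ℝ => x ^ 2) μ) {a b : ℂ} {c : ℝ} (hc : 0 < c) (hl : LB c a b) :
    TT a b μ = (starRingEnd ℂ a) * (QQ a b μ : ℂ) + (starRingEnd ℂ b) * (PP a b μ : ℂ) := by
  unfold TT QQ PP
  rw [← integral_complex_ofReal, ← integral_complex_ofReal, ← integral_const_mul,
    ← integral_const_mul, ← integral_add]
  · refine integral_congr_ae ?_
    filter_upwards [ae_nonneg_of h0] with x hx
    have h1 := hl x hx
    have h3 : a * (x : ℂ) + b ≠ 0 := by
      intro h; rw [h] at h1; simp at h1; linarith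
    have h4 : ((‖a * (x : ℂ) + b‖ : ℂ)) ^ 2 = (a * x + b) * (starRingEnd ℂ (a * x + b)) := by
      rw [Complex.mul_conj, Complex.normSq_eq_norm_sq]; push_cast; rfl
    have h5 : starRingEnd ℂ (a * x + b) ≠ 0 := (map_ne_zero _).2 h3
    simp only [Complex.ofReal_div, Complex.ofReal_pow, div_pow]
    rw [h4]
    have h6 : starRingEnd ℂ (a * x + b) = starRingEnd ℂ a * x + starRingEnd ℂ b := by simp
    have h7 : starRingEnd ℂ a * ((x : ℂ) ^ 2 / ((a * x + b) * starRingEnd ℂ (a * x + b)))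
        + starRingEnd ℂ b * (x / ((a * x + b) * starRingEnd ℂ (a * x + b)))
        = (x * starRingEnd ℂ (a * x + b)) / ((a * x + b) * starRingEnd ℂ (a * x + b)) := by
      rw [h6]; ring
    rw [h7, mul_div_mul_right _ _ h5]
  · exact (Integrable.ofReal (int_Q h0 h2 hc hl)).const_mul _
  · exact (Integrable.ofReal (int_P h0 h2 hc hl)).const_mul _

theorem TT_sq_le {μ : Measure ℝ} [IsProbabilityMeasure μ] (h0 : μ (Set.Iio 0) = 0)
    (h2 : Integrable (fun x : ℝ => x ^ 2) μ) {a b : ℂ} {c : ℝ} (hc : 0 < c) (hl : LB c a b) :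
    ‖TT a b μ‖ ^ 2 ≤ QQ a b μ := by
  have h3 : ‖TT a b μ‖ ≤ ∫ x, x / ‖a * (x : ℂ) + b‖ ∂μ := by
    refine norm_integral_le_of_norm_le (int_N h0 h2 hc hl) ?_
    filter_upwards [ae_nonneg_of h0] with x hx
    rw [norm_div, Complex.norm_real, Real.norm_eq_abs, abs_of_nonneg hx]
  have h4 := cs_sq (u := fun x => x / ‖a * (x : ℂ) + b‖) (v := fun _ => (1 : ℝ))
    (int_Q h0 h2 hc hl) (by simp) (by simpa using int_N h0 h2 hc hl)
  simp at h4
  calc ‖TT a b μ‖ ^ 2 ≤ (∫ x, x / ‖a * (x : ℂ) + b‖ ∂μ) ^ 2 := by gcongr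
    _ ≤ _ := h4

theorem TT_sub {μ : Measure ℝ} [IsProbabilityMeasure μ] (h0 : μ (Set.Iio 0) = 0)
    (h2 : Integrable (fun x : ℝ => x ^ 2) μ) {a a' b : ℂ} {c c' : ℝ} (hc : 0 < c)
    (hl : LB c a b) (hc' : 0 < c') (hl' : LB c' a' b) :
    ‖TT a b μ - TT a' b μ‖ ^ 2 ≤ ‖a - a'‖ ^ 2 * (QQ a b μ * QQ a' b μ) := by
  have hi : Integrable (fun x : ℝ => (x / ‖a * (x : ℂ) + b‖) * (x / ‖a' * (x : ℂ) + b‖)) μ := by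
    refine ((int_Q h0 h2 hc hl).add (int_Q h0 h2 hc' hl')).mono' (Measurable.aestronglyMeasurable (by fun_prop)) ?_
    filter_upwards with x
    simp only [Pi.add_apply]
    rw [Real.norm_eq_abs, abs_le]
    constructor <;> nlinarith [sq_nonneg ((x / ‖a * (x : ℂ) + b‖) - (x / ‖a' * (x : ℂ) + b‖)),
      sq_nonneg ((x / ‖a * (x : ℂ) + b‖) + (x / ‖a' * (x : ℂ) + b‖)),
      sq_nonneg (x / ‖a * (x : ℂ) + b‖), sq_nonneg (x / ‖a' * (x : ℂ) + b‖)]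
  have h3 : ‖TT a b μ - TT a' b μ‖ ≤
      ‖a - a'‖ * ∫ x, (x / ‖a * (x : ℂ) + b‖) * (x / ‖a' * (x : ℂ) + b‖) ∂μ := by
    unfold TT
    rw [← integral_sub (int_T h0 h2 hc hl) (int_T h0 h2 hc' hl'), ← integral_const_mul]
    refine norm_integral_le_of_norm_le (hi.const_mul _) ?_
    filter_upwards [ae_nonneg_of h0] with x hx
    have h1 := hl x hx
    have h1' := hl' x hx
    have e : a * (x : ℂ) + b ≠ 0 := by
      intro h; rw [h] at h1; simp at h1; linarith
    have e' : a' * (x : ℂ) + b ≠ 0 := by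
      intro h; rw [h] at h1'; simp at h1'; linarith
    have : (x : ℂ) / (a * x + b) - x / (a' * x + b) =
        (a' - a) * ((x / (a * x + b)) * (x / (a' * x + b))) := by
      rw [div_sub_div _ _ e e', div_mul_div_comm, ← mul_div_assoc]
      congr 1; ring
    rw [this, norm_mul, norm_mul, norm_div, norm_div, Complex.norm_real, Real.norm_eq_abs,
      abs_of_nonneg hx, norm_sub_rev]
  have h4 := cs_sq (int_Q h0 h2 hc hl) (int_Q h0 h2 hc' hl') hi
  calc _ ≤ (‖a - a'‖ * ∫ x, (x / ‖a * (x : ℂ) + b‖) * (x / ‖a' * (x : ℂ) + b‖) ∂μ) ^ 2 := by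
        gcongr
    _ = ‖a - a'‖ ^ 2 * (∫ x, (x / ‖a * (x : ℂ) + b‖) * (x / ‖a' * (x : ℂ) + b‖) ∂μ) ^ 2 := by
        ring
    _ ≤ _ := by gcongr; exact h4

/-- Truncation -/
theorem trunc_bd {y N : ℝ} (hN : 0 < N) : |y - max (-N) (min N y)| ≤ y ^ 2 / N := by
  rw [le_div_iff₀ hN]
  rcases le_total y (-N) with h | h
  · rw [min_eq_right (by linarith), max_eq_left h, abs_of_nonpos (by linarith)]
    nlinarith
  · rcases le_total y N with h' | h'
    · rw [min_eq_right h', max_eq_right h]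
      simp; positivity
    · rw [min_eq_left h', max_eq_right (by linarith), abs_of_nonneg (by linarith)]
      nlinarith

theorem weak_real {μ : ℕ → Measure ℝ} {ν : Measure ℝ} [∀ n, IsProbabilityMeasure (μ n)]
    [IsProbabilityMeasure ν] (hw : WeakLim μ ν) {B : ℝ}
    (hi : ∀ n, Integrable (fun x : ℝ => x ^ 2) (μ n)) (hb : ∀ n, ∫ x, x ^ 2 ∂(μ n) ≤ B)
    (hν : Integrable (fun x : ℝ => x ^ 2) ν) {f : ℝ → ℝ} (hf : Continuous f) {M : ℝ}
    (hM : ∀ x, |f x| ≤ M * |x|) :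
    Tendsto (fun n => ∫ x, f x ∂(μ n)) atTop (𝓝 (∫ x, f x ∂ν)) := by
  have hM2 : ∀ x, f x ^ 2 ≤ M ^ 2 * x ^ 2 := by
    intro x
    rw [← sq_abs (f x), ← sq_abs x, ← mul_pow]
    have := hM x
    gcongr
  have gen : ∀ (ρ : Measure ℝ) [IsProbabilityMeasure ρ], Integrable (fun x : ℝ => x ^ 2) ρ →
      ∀ B' N : ℝ, ∫ x, x ^ 2 ∂ρ ≤ B' → 0 < N →
      |∫ x, f x ∂ρ - ∫ x, max (-N) (min N (f x)) ∂ρ| ≤ M ^ 2 * B' / N := by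
    intro ρ _ hρ B' N hB' hN
    have hif : Integrable f ρ := by
      refine ((int_id hρ).abs.const_mul M).mono' hf.aestronglyMeasurable (ae_of_all _ hM)
    have hig : Integrable (fun x => max (-N) (min N (f x))) ρ :=
      (integrable_const (-N)).sup ((integrable_const N).inf hif)
    rw [← integral_sub hif hig, ← Real.norm_eq_abs]
    calc _ ≤ ∫ x, M ^ 2 / N * x ^ 2 ∂ρ := by
          refine norm_integral_le_of_norm_le (hρ.const_mul _) (ae_of_all _ fun x => ?_)
          refine (trunc_bd hN).trans ?_
          have := hM2 x
          calc f x ^ 2 / N ≤ M ^ 2 * x ^ 2 / N := by gcongr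
            _ = _ := by ring
      _ = M ^ 2 / N * ∫ x, x ^ 2 ∂ρ := integral_const_mul _ _
      _ ≤ M ^ 2 / N * B' := by gcongr
      _ = _ := by ring
  rw [Metric.tendsto_atTop]
  intro ε hε
  set B' := max B (∫ x, x ^ 2 ∂ν) with hB'
  have hBn : 0 ≤ B' := le_max_of_le_right (integral_nonneg fun x => sq_nonneg x)
  set N : ℝ := 3 * (M ^ 2 * B' + 1) / ε with hN
  have hNp : 0 < N := by positivity
  have hsm : M ^ 2 * B' / N < ε / 3 := by
    rw [div_lt_iff₀ hNp, hN]
    field_simp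
    linarith
  let g : BoundedContinuousFunction ℝ ℝ := BoundedContinuousFunction.ofNormedAddCommGroup
    (fun x => max (-N) (min N (f x))) (by fun_prop) N (by
      intro x
      rw [Real.norm_eq_abs, abs_le]
      exact ⟨le_max_left _ _, max_le (by linarith) (min_le_left _ _)⟩)
  have hg := hw g
  rw [Metric.tendsto_atTop] at hg
  obtain ⟨n0, hn0⟩ := hg (ε / 3) (by positivity)
  refine ⟨n0, fun n hn => ?_⟩
  have h1 := hn0 n hn
  have h2 := gen (μ n) (hi n) B' N ((hb n).trans (le_max_left _ _)) hNp
  have h3 := gen ν hν B' N (le_max_right _ _) hNp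
  rw [Real.dist_eq] at h1 ⊢
  change |∫ x, max (-N) (min N (f x)) ∂(μ n) - ∫ x, max (-N) (min N (f x)) ∂ν| < ε / 3 at h1
  rw [abs_lt] at h1 ⊢
  rw [abs_le] at h2 h3
  constructor <;> linarith [h1.1, h1.2, h2.1, h2.2, h3.1, h3.2]

theorem weak_TT {μ : ℕ → Measure ℝ} {ν : Measure ℝ} [∀ n, IsProbabilityMeasure (μ n)]
    [IsProbabilityMeasure ν] (hw : WeakLim μ ν) {B : ℝ}
    (h0 : ∀ n, μ n (Set.Iio 0) = 0) (h0' : ν (Set.Iio 0) = 0)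
    (hi : ∀ n, Integrable (fun x : ℝ => x ^ 2) (μ n)) (hb : ∀ n, ∫ x, x ^ 2 ∂(μ n) ≤ B)
    (hν : Integrable (fun x : ℝ => x ^ 2) ν) {a b : ℂ} {c : ℝ} (hc : 0 < c) (hl : LB c a b) :
    Tendsto (fun n => TT a b (μ n)) atTop (𝓝 (TT a b ν)) := by
  let F : ℝ → ℂ := fun x => ((max x 0 : ℝ) : ℂ) / (a * ((max x 0 : ℝ) : ℂ) + b)
  have hden : ∀ x : ℝ, c ≤ ‖a * ((max x 0 : ℝ) : ℂ) + b‖ := fun x => hl _ (le_max_right _ _)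
  have hF : Continuous F := by
    refine Continuous.div (by fun_prop) (by fun_prop) fun x h => ?_
    have := hden x
    rw [h] at this; simp at this; linarith
  have hFb : ∀ x, ‖F x‖ ≤ c⁻¹ * |x| := by
    intro x
    have h1 := hden x
    simp only [F]
    rw [norm_div, Complex.norm_real, Real.norm_eq_abs, abs_of_nonneg (le_max_right _ _)]
    calc max x 0 / ‖a * ((max x 0 : ℝ) : ℂ) + b‖ ≤ |x| / c := by
          gcongr
          exact max_le (le_abs_self _) (abs_nonneg _)
      _ = _ := by ring
  have hre := weak_real hw hi hb hν (f := fun x => (F x).re) (by fun_prop) (M := c⁻¹)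
    fun x => (Complex.abs_re_le_norm _).trans (hFb x)
  have him := weak_real hw hi hb hν (f := fun x => (F x).im) (by fun_prop) (M := c⁻¹)
    fun x => (Complex.abs_im_le_norm _).trans (hFb x)
  have gen : ∀ (ρ : Measure ℝ) [IsProbabilityMeasure ρ], Integrable (fun x : ℝ => x ^ 2) ρ →
      ρ (Set.Iio 0) = 0 →
      TT a b ρ = ((∫ x, (F x).re ∂ρ : ℝ) : ℂ) + ((∫ x, (F x).im ∂ρ : ℝ) : ℂ) * Complex.I := by
    intro ρ _ h2 hρ0
    have hFi : Integrable F ρ :=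
      ((int_id h2).abs.const_mul c⁻¹).mono' hF.aestronglyMeasurable (ae_of_all _ hFb)
    have e : TT a b ρ = ∫ x, F x ∂ρ := by
      refine integral_congr_ae ?_
      filter_upwards [ae_nonneg_of hρ0] with x hx
      simp only [F, max_eq_left hx]
    rw [e]
    exact (integral_re_add_im hFi).symm
  rw [gen ν hν h0']
  simp_rw [fun n => gen (μ n) (hi n) (h0 n)]
  exact ((Complex.continuous_ofReal.tendsto _).comp hre).add
    (((Complex.continuous_ofReal.tendsto _).comp him).mul_const _)

theorem weak_TT' {μ : ℕ → Measure ℝ} {ν : Measure ℝ} [∀ n, IsProbabilityMeasure (μ n)]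
    [IsProbabilityMeasure ν] (hw : WeakLim μ ν) {B : ℝ}
    (h0 : ∀ n, μ n (Set.Iio 0) = 0) (h0' : ν (Set.Iio 0) = 0)
    (hi : ∀ n, Integrable (fun x : ℝ => x ^ 2) (μ n)) (hb : ∀ n, ∫ x, x ^ 2 ∂(μ n) ≤ B)
    (hν : Integrable (fun x : ℝ => x ^ 2) ν) {a : ℕ → ℂ} {a' b : ℂ} {c : ℝ} (hc : 0 < c)
    (ha : Tendsto a atTop (𝓝 a')) (hl : ∀ᶠ n in atTop, LB c (a n) b) :
    LB c a' b ∧ Tendsto (fun n => TT (a n) b (μ n)) atTop (𝓝 (TT a' b ν)) := by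
  have hl' : LB c a' b := by
    intro x hx
    refine ge_of_tendsto (((ha.mul_const (x : ℂ)).add_const b).norm) ?_
    filter_upwards [hl] with n hn using hn x hx
  refine ⟨hl', ?_⟩
  have h1 := weak_TT hw h0 h0' hi hb hν hc hl'
  have h2 : Tendsto (fun n => TT (a n) b (μ n) - TT a' b (μ n)) atTop (𝓝 0) := by
    have h3 : Tendsto (fun n => ‖a n - a'‖ * (B / c ^ 2)) atTop (𝓝 0) := by
      have := (tendsto_iff_norm_sub_tendsto_zero.1 ha).mul_const (B / c ^ 2)
      simpa using this
    refine squeeze_zero_norm' ?_ h3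
    filter_upwards [hl] with n hn
    have hB : 0 ≤ B := (integral_nonneg fun x => sq_nonneg x).trans (hb n)
    have h4 := TT_sub (h0 n) (hi n) hc hn hc hl'
    have h5 := QQ_le (h0 n) (hi n) hc hn (hb n)
    have h6 := QQ_le (h0 n) (hi n) hc hl' (hb n)
    refine abs_le_of_sq_le_sq' ?_ (by positivity) |>.2
    refine h4.trans ?_
    rw [mul_pow, sq (B / c ^ 2)]
    have := QQ_nonneg a' b (μ n)
    gcongr
  simpa using h2.add h1

/-- regions -/
def Reg (z h : ℂ) : Prop :=
  (z.im ≠ 0 ∧ 0 < h.im * z.im) ∨ (z.im = 0 ∧ z.re < 0 ∧ h.im = 0 ∧ 0 < h.re)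
def Regc (z k : ℂ) : Prop :=
  (z.im ≠ 0 ∧ k.im * z.im ≤ 0) ∨ (z.im = 0 ∧ z.re < 0 ∧ k.im = 0 ∧ 0 ≤ k.re)

theorem lb_h {z h : ℂ} (hr : Reg z h) {M δ : ℝ} (hM : 0 < M) (hhM : ‖h‖ ≤ M)
    (hδ : z.im ≠ 0 → δ ≤ |h.im|) : LB (min 1 (δ / M)) h 1 := by
  intro x hx
  rcases hr with ⟨hz, _⟩ | ⟨_, _, h1, h2⟩
  · refine (min_le_right _ _).trans ?_
    rw [div_le_iff₀ hM]
    have e : ((starRingEnd ℂ h) * (h * x + 1)).im = - h.im := by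
      simp [Complex.mul_im, Complex.mul_re]; ring
    calc δ ≤ |h.im| := hδ hz
      _ = |((starRingEnd ℂ h) * (h * x + 1)).im| := by rw [e, abs_neg]
      _ ≤ ‖(starRingEnd ℂ h) * (h * x + 1)‖ := Complex.abs_im_le_norm _
      _ = ‖h * x + 1‖ * ‖h‖ := by rw [norm_mul, RCLike.norm_conj, mul_comm]
      _ ≤ _ := by gcongr
  · refine (min_le_left _ _).trans ?_
    refine le_trans ?_ (Complex.re_le_norm _)
    simp [h1]
    positivity

theorem lb_h' {z h : ℂ} (hr : Reg z h) : ∃ c, 0 < c ∧ LB c h 1 := by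
  refine ⟨min 1 ((if z.im = 0 then 1 else |h.im|) / (‖h‖ + 1)), ?_,
    lb_h hr (by positivity) (by linarith) (fun hz => by simp [hz])⟩
  refine lt_min one_pos (div_pos ?_ (by positivity))
  split_ifs with hz
  · exact one_pos
  · rcases hr with ⟨_, h1⟩ | ⟨h1, _⟩
    · exact abs_pos.2 (by rintro h; simp [h] at h1)
    · exact absurd h1 hz

theorem lb_k {z : ℂ} (hz : z ∈ cutPlane) :
    ∃ c, 0 < c ∧ ∀ k, Regc z k → LB c k (-z) := by
  by_cases h : z.im = 0
  · have hre : z.re < 0 := by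
      by_contra h'; exact hz ⟨h, not_lt.1 h'⟩
    refine ⟨-z.re, by linarith, fun k hk x hx => ?_⟩
    rcases hk with ⟨h1, _⟩ | ⟨_, _, h1, h2⟩
    · exact absurd h h1
    · refine le_trans ?_ (Complex.re_le_norm _)
      simp
      positivity
  · refine ⟨|z.im|, abs_pos.2 h, fun k hk x hx => ?_⟩
    rcases hk with ⟨_, h1⟩ | ⟨h1, _⟩
    · refine le_trans ?_ (Complex.abs_im_le_norm _)
      simp
      apply sq_le_sq.1
      nlinarith [mul_nonneg (neg_nonneg.2 h1) hx, sq_nonneg (k.im * x)]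
    · exact absurd h1 h

theorem regc_of {z h : ℂ} (hr : Reg z h) {μ : Measure ℝ} [IsProbabilityMeasure μ]
    (h0 : μ (Set.Iio 0) = 0) (h2 : Integrable (fun x : ℝ => x ^ 2) μ) :
    Regc z (TT h 1 μ) := by
  obtain ⟨c, hc, hl⟩ := lb_h' hr
  have hQ := QQ_nonneg h 1 μ
  have hP := PP_nonneg h 1 h0
  rw [TT_eq h0 h2 hc hl]
  rcases hr with ⟨hz, h1⟩ | ⟨hz, hz', h1, h3⟩
  · refine Or.inl ⟨hz, ?_⟩
    simp
    nlinarith [mul_nonneg h1.le hQ]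
  · refine Or.inr ⟨hz, hz', ?_, ?_⟩
    · simp [h1]
    · simp
      positivity

theorem reg_of {z k : ℂ} (hz : z ∈ cutPlane) (hr : Regc z k) {μ : Measure ℝ}
    [IsProbabilityMeasure μ] (h0 : μ (Set.Iio 0) = 0)
    (h2 : Integrable (fun x : ℝ => x ^ 2) μ) (hμ : μ {0} < 1) :
    Reg z (TT k (-z) μ) := by
  obtain ⟨c, hc, hl'⟩ := lb_k hz
  have hl := hl' k hr
  have hQ := QQ_nonneg k (-z) μ
  have hP := PP_pos h0 h2 hc hl hμ
  rw [TT_eq h0 h2 hc hl]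
  rcases hr with ⟨hz, h1⟩ | ⟨hz, hz', h1, h3⟩
  · refine Or.inl ⟨hz, ?_⟩
    simp
    have : 0 < z.im ^ 2 := by positivity
    nlinarith [mul_nonneg (neg_nonneg.2 h1) hQ, mul_pos this hP]
  · refine Or.inr ⟨hz, hz', ?_, ?_⟩
    · simp [h1, hz]
    · simp
      nlinarith [mul_nonneg h3 hQ, mul_pos (neg_pos.2 hz') hP]

theorem ac_ident {z h k : ℂ} (hz : z ∈ cutPlane) (hr : Reg z h) {μR μK : Measure ℝ}
    [IsProbabilityMeasure μR] [IsProbabilityMeasure μK]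
    (hR0 : μR (Set.Iio 0) = 0) (hR2 : Integrable (fun x : ℝ => x ^ 2) μR)
    (hK0 : μK (Set.Iio 0) = 0) (hK2 : Integrable (fun x : ℝ => x ^ 2) μK)
    (eh : h = TT k (-z) μR) (ek : k = TT h 1 μK) :
    QQ h 1 μK * QQ k (-z) μR ≤ 1 ∧ (μR {0} < 1 → QQ h 1 μK * QQ k (-z) μR < 1) := by
  have hk : Regc z k := ek ▸ regc_of hr hK0 hK2
  obtain ⟨c, hc, hl⟩ := lb_h' hr
  obtain ⟨c', hc', hl''⟩ := lb_k hz
  have hl' := hl'' k hk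
  have e1 := TT_eq hR0 hR2 hc' hl'
  have e2 := TT_eq hK0 hK2 hc hl
  rw [← eh] at e1
  rw [← ek] at e2
  have hD := PP_nonneg k (-z) hR0
  have hD' : μR {0} < 1 → 0 < PP k (-z) μR := PP_pos hR0 hR2 hc' hl'
  have hE := PP_nonneg h 1 hK0
  have hA := QQ_nonneg h 1 μK
  have hC := QQ_nonneg k (-z) μR
  generalize QQ h 1 μK = A at *
  generalize QQ k (-z) μR = C at *
  generalize PP k (-z) μR = D at *
  generalize PP h 1 μK = E at *
  have e1r := congrArg Complex.re e1
  have e1i := congrArg Complex.im e1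
  have e2r := congrArg Complex.re e2
  have e2i := congrArg Complex.im e2
  simp at e1r e1i e2r e2i
  rcases hr with ⟨hz1, h1⟩ | ⟨hz1, hz', h1, h3⟩
  · have hzz : 0 < z.im ^ 2 := by positivity
    have key : (h.im * z.im) * (1 - A * C) = z.im ^ 2 * D := by
      rw [e2i] at e1i
      linear_combination z.im * e1i
    constructor
    · by_contra hh
      nlinarith [mul_nonneg hzz.le hD, mul_pos h1 (sub_pos.2 (not_le.1 hh))]
    · intro hm
      by_contra hh
      nlinarith [mul_pos hzz (hD' hm), mul_nonneg h1.le (sub_nonneg.2 (not_lt.1 hh))]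
  · have key : h.re * (1 - A * C) = E * C + (-z.re) * D := by
      rw [e2r] at e1r
      linear_combination e1r
    have hEC := mul_nonneg hE hC
    constructor
    · by_contra hh
      nlinarith [mul_nonneg (neg_pos.2 hz').le hD, mul_pos h3 (sub_pos.2 (not_le.1 hh))]
    · intro hm
      by_contra hh
      nlinarith [mul_pos (neg_pos.2 hz') (hD' hm),
        mul_nonneg h3.le (sub_nonneg.2 (not_lt.1 hh))]

theorem sol_unique {z h k h' k' : ℂ} (hz : z ∈ cutPlane) (hr : Reg z h) (hr' : Reg z h')
    {μR μK : Measure ℝ}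
    [IsProbabilityMeasure μR] [IsProbabilityMeasure μK]
    (hR0 : μR (Set.Iio 0) = 0) (hR2 : Integrable (fun x : ℝ => x ^ 2) μR)
    (hK0 : μK (Set.Iio 0) = 0) (hK2 : Integrable (fun x : ℝ => x ^ 2) μK)
    (hR : μR {0} < 1)
    (eh : h = TT k (-z) μR) (ek : k = TT h 1 μK)
    (eh' : h' = TT k' (-z) μR) (ek' : k' = TT h' 1 μK) : h = h' ∧ k = k' := by
  have a1 := (ac_ident hz hr hR0 hR2 hK0 hK2 eh ek).2 hR
  have a2 := (ac_ident hz hr' hR0 hR2 hK0 hK2 eh' ek').2 hR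
  have hk : Regc z k := ek ▸ regc_of hr hK0 hK2
  have hk' : Regc z k' := ek' ▸ regc_of hr' hK0 hK2
  obtain ⟨c, hc, hl⟩ := lb_h' hr
  obtain ⟨c', hc', hl'⟩ := lb_h' hr'
  obtain ⟨d, hd, hld⟩ := lb_k hz
  have s1 := TT_sub hR0 hR2 hd (hld k hk) hd (hld k' hk')
  have s2 := TT_sub hK0 hK2 hc hl hc' hl'
  rw [← eh, ← eh'] at s1
  rw [← ek, ← ek'] at s2
  have q1 := QQ_nonneg h 1 μK
  have q2 := QQ_nonneg k (-z) μR
  have q3 := QQ_nonneg h' 1 μK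
  have q4 := QQ_nonneg k' (-z) μR
  have hh : h = h' := by
    by_contra hne
    have hp : 0 < ‖h - h'‖ ^ 2 := by
      have := norm_pos_iff.2 (sub_ne_zero.2 hne)
      positivity
    have t1 : ‖h - h'‖ ^ 2 ≤ ‖h - h'‖ ^ 2 *
        ((QQ h 1 μK * QQ k (-z) μR) * (QQ h' 1 μK * QQ k' (-z) μR)) := by
      calc _ ≤ _ := s1
        _ ≤ ‖h - h'‖ ^ 2 * (QQ h 1 μK * QQ h' 1 μK) * (QQ k (-z) μR * QQ k' (-z) μR) := by
          gcongr
        _ = _ := by ring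
    have t2 : (QQ h 1 μK * QQ k (-z) μR) * (QQ h' 1 μK * QQ k' (-z) μR) < 1 :=
      mul_lt_one_of_nonneg_of_lt_one_left (by positivity) a1 a2.le
    nlinarith
  exact ⟨hh, by rw [ek, ek', hh]⟩

theorem sol_bound {z h k : ℂ} (hz : z ∈ cutPlane) (hr : Reg z h) {μR μK : Measure ℝ}
    [IsProbabilityMeasure μR] [IsProbabilityMeasure μK]
    (hR0 : μR (Set.Iio 0) = 0) (hR2 : Integrable (fun x : ℝ => x ^ 2) μR)
    (hK0 : μK (Set.Iio 0) = 0) (hK2 : Integrable (fun x : ℝ => x ^ 2) μK) {B : ℝ}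
    (hB : ∫ x, x ^ 2 ∂μK ≤ B)
    (eh : h = TT k (-z) μR) (ek : k = TT h 1 μK) : ‖k‖ ≤ 2 * √B := by
  have a1 := (ac_ident hz hr hR0 hR2 hK0 hK2 eh ek).1
  have hk : Regc z k := ek ▸ regc_of hr hK0 hK2
  obtain ⟨c, hc, hl⟩ := lb_h' hr
  obtain ⟨d, hd, hld⟩ := lb_k hz
  have l0 : LB 1 0 1 := by intro x hx; simp
  have s0 := TT_sq_le hR0 hR2 hd (hld k hk)
  rw [← eh] at s0
  have s1 := TT_sub hK0 hK2 hc hl one_pos l0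
  have s2 := TT_sq_le hK0 hK2 one_pos l0
  have s3 := QQ_le hK0 hK2 one_pos l0 hB
  rw [← ek] at s1
  simp only [one_pow, div_one, sub_zero] at s1 s3
  have q1 := QQ_nonneg h 1 μK
  have q2 := QQ_nonneg 0 1 μK
  have s4 : ‖k - TT 0 1 μK‖ ^ 2 ≤ B := by
    calc _ ≤ _ := s1
      _ ≤ QQ k (-z) μR * (QQ h 1 μK * QQ 0 1 μK) := by gcongr
      _ = (QQ h 1 μK * QQ k (-z) μR) * QQ 0 1 μK := by ring
      _ ≤ 1 * QQ 0 1 μK := by gcongr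
      _ ≤ B := by linarith
  have t1 := Real.le_sqrt_of_sq_le s4
  have t2 := Real.le_sqrt_of_sq_le (s2.trans s3)
  calc ‖k‖ = ‖(k - TT 0 1 μK) + TT 0 1 μK‖ := by simp
    _ ≤ _ := norm_add_le _ _
    _ ≤ _ := by linarith

theorem WeakLim.subseq {μ : ℕ → Measure ℝ} {ν : Measure ℝ} (hw : WeakLim μ ν) {φ : ℕ → ℕ}
    (hφ : Tendsto φ atTop atTop) : WeakLim (fun n => μ (φ n)) ν :=
  fun f => (hw f).comp hφ

theorem regc_closed {z k : ℂ} {kn : ℕ → ℂ} (hk : ∀ n, Regc z (kn n))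
    (ht : Tendsto kn atTop (𝓝 k)) : Regc z k := by
  have hre := (Complex.continuous_re.tendsto _).comp ht
  have him := (Complex.continuous_im.tendsto _).comp ht
  by_cases hz : z.im = 0
  · have h1 : ∀ n, z.re < 0 ∧ (kn n).im = 0 ∧ 0 ≤ (kn n).re := fun n => by
      rcases hk n with ⟨h, _⟩ | ⟨_, h⟩
      · exact absurd hz h
      · exact h
    refine Or.inr ⟨hz, (h1 0).1, ?_, ?_⟩
    · refine tendsto_nhds_unique him ?_
      simp [Function.comp_def, fun n => (h1 n).2.1]
    · exact ge_of_tendsto' hre fun n => (h1 n).2.2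
  · refine Or.inl ⟨hz, le_of_tendsto' (him.mul_const z.im) fun n => ?_⟩
    rcases hk n with ⟨_, h⟩ | ⟨h, _⟩
    · exact h
    · exact absurd h hz

theorem adm_reg {h : ℂ → ℂ} (ha : AdmissibleH h) {z : ℂ} (hz : z ∈ cutPlane) : Reg z (h z) := by
  obtain ⟨_, _, h1, h2, _⟩ := ha
  by_cases hi : z.im = 0
  · have hre : z.re < 0 := by
      by_contra h'; exact hz ⟨hi, not_lt.1 h'⟩
    have e : ((z.re : ℝ) : ℂ) = z := by apply Complex.ext <;> simp [hi]
    have := h1 z.re hre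
    rw [e] at this
    exact Or.inr ⟨hi, hre, this⟩
  · exact Or.inl ⟨hi, h2 z hi⟩

/-- **Continuity of the solution of the functional system in the data.**
If probability measures `ν_{K^{(p)}}, ν_{R^{(p)}}` on `[0,∞)` have uniformly bounded second
moments and converge weakly to `ν_K, ν_R` (with finite second moments, not concentrated at
zero), then the corresponding admissible solutions `(h^{(p)}, k^{(p)})` of the system converge
pointwise on `ℂ∖[0,∞)` to the admissible solution `(h,k)` for the limiting measures. -/
theorem system_solution_continuity
    (νKp νRp : ℕ → Measure ℝ)
    (hKpprob : ∀ p, IsProbabilityMeasure (νKp p)) (hRpprob : ∀ p, IsProbabilityMeasure (νRp p))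
    (hKpsupp : ∀ p, νKp p (Set.Iio 0) = 0) (hRpsupp : ∀ p, νRp p (Set.Iio 0) = 0)
    (hKpint : ∀ p, MeasureTheory.Integrable (fun x : ℝ => x ^ 2) (νKp p))
    (hRpint : ∀ p, MeasureTheory.Integrable (fun x : ℝ => x ^ 2) (νRp p))
    (B : ℝ)
    (hbdd : ∀ p, (∫ x : ℝ, x ^ 2 ∂(νKp p)) ≤ B ∧ (∫ x : ℝ, x ^ 2 ∂(νRp p)) ≤ B)
    (νK νR : Measure ℝ) [IsProbabilityMeasure νK] [IsProbabilityMeasure νR]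
    (hKsupp : νK (Set.Iio 0) = 0) (hRsupp : νR (Set.Iio 0) = 0)
    (hK2 : MeasureTheory.Integrable (fun x : ℝ => x ^ 2) νK)
    (hR2 : MeasureTheory.Integrable (fun x : ℝ => x ^ 2) νR)
    (hK0 : νK {0} < 1) (hR0 : νR {0} < 1)
    (hweakK : WeakLim νKp νK) (hweakR : WeakLim νRp νR)
    (hp kp : ℕ → ℂ → ℂ)
    (hap : ∀ p, AdmissibleH (hp p)) (hsp : ∀ p, SolvesSystem (hp p) (kp p) (νRp p) (νKp p))
    (h k : ℂ → ℂ)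
    (ha : AdmissibleH h) (hs : SolvesSystem h k νR νK) :
    ∀ z ∈ cutPlane,
      Tendsto (fun p => hp p z) atTop (𝓝 (h z)) ∧
      Tendsto (fun p => kp p z) atTop (𝓝 (k z)) := by
  intro z hz
  have eqs : ∀ {h k : ℂ → ℂ} {νR νK : Measure ℝ}, SolvesSystem h k νR νK →
      h z = TT (k z) (-z) νR ∧ k z = TT (h z) 1 νK := fun hS => hS z hz
  obtain ⟨eh, ek⟩ := eqs hs
  have hr := adm_reg ha hz
  have hrp := fun p => adm_reg (hap p) hz
  have hkp : ∀ p, Regc z (kp p z) := fun p => by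
    rw [(eqs (hsp p)).2]; exact regc_of (hrp p) (hKpsupp p) (hKpint p)
  obtain ⟨d, hd, hld⟩ := lb_k hz
  have bk : ∀ p, ‖kp p z‖ ≤ 2 * √B := fun p =>
    sol_bound hz (hrp p) (hRpsupp p) (hRpint p) (hKpsupp p) (hKpint p) (hbdd p).1
      (eqs (hsp p)).1 (eqs (hsp p)).2
  have bh : ∀ p, ‖hp p z‖ ≤ √(B / d ^ 2) := fun p => by
    refine Real.le_sqrt_of_sq_le ?_
    rw [(eqs (hsp p)).1]
    exact (TT_sq_le (hRpsupp p) (hRpint p) hd (hld _ (hkp p))).trans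
      (QQ_le (hRpsupp p) (hRpint p) hd (hld _ (hkp p)) (hbdd p).2)
  have main : Tendsto (fun p => (hp p z, kp p z)) atTop (𝓝 (h z, k z)) := by
    refine tendsto_of_subseq_tendsto fun ns hns => ?_
    have hcomp : IsCompact (Metric.closedBall (0 : ℂ) (√(B / d ^ 2)) ×ˢ
        Metric.closedBall (0 : ℂ) (2 * √B)) :=
      (isCompact_closedBall _ _).prod (isCompact_closedBall _ _)
    obtain ⟨⟨h', k'⟩, _, φ, hφ, ht⟩ := hcomp.tendsto_subseq
      (x := fun n => (hp (ns n) z, kp (ns n) z))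
      (fun n => ⟨by simpa using bh (ns n), by simpa using bk (ns n)⟩)
    refine ⟨φ, ?_⟩
    have hψ : Tendsto (fun n => ns (φ n)) atTop atTop := hns.comp hφ.tendsto_atTop
    have th : Tendsto (fun n => hp (ns (φ n)) z) atTop (𝓝 h') :=
      (continuous_fst.tendsto _).comp ht
    have tk : Tendsto (fun n => kp (ns (φ n)) z) atTop (𝓝 k') :=
      (continuous_snd.tendsto _).comp ht
    have wR := hweakR.subseq hψ
    have wK := hweakK.subseq hψ
    have rk' : Regc z k' := regc_closed (fun n => hkp (ns (φ n))) tk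
    have eh' : h' = TT k' (-z) νR := by
      have := (weak_TT' wR (fun n => hRpsupp _) hRsupp (fun n => hRpint _)
        (fun n => (hbdd _).2) hR2 hd tk (Eventually.of_forall fun n => hld _ (hkp _))).2
      refine tendsto_nhds_unique th (this.congr fun n => ?_)
      exact (eqs (hsp _)).1.symm
    have rh' : Reg z h' := eh' ▸ reg_of hz rk' hRsupp hR2 hR0
    have ek' : k' = TT h' 1 νK := by
      set δ : ℝ := if z.im = 0 then 1 else |h'.im| / 2 with hδ
      have hδp : 0 < δ := by
        rw [hδ]
        split_ifs with hz0
        · exact one_pos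
        · rcases rh' with ⟨_, h1⟩ | ⟨h1, _⟩
          · have : 0 < |h'.im| := abs_pos.2 (by rintro h; simp [h] at h1)
            positivity
          · exact absurd h1 hz0
      have hM : 0 < √(B / d ^ 2) + 1 := by positivity
      have hev : ∀ᶠ n in atTop, LB (min 1 (δ / (√(B / d ^ 2) + 1))) (hp (ns (φ n)) z) 1 := by
        have : ∀ᶠ n in atTop, z.im ≠ 0 → δ ≤ |(hp (ns (φ n)) z).im| := by
          by_cases hz0 : z.im = 0
          · exact Eventually.of_forall fun n hn => absurd hz0 hn
          · have h3 := ((Complex.continuous_im.tendsto _).comp th).abs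
            have h4 : δ < |h'.im| := by
              rw [hδ, if_neg hz0] at hδp ⊢
              linarith
            filter_upwards [h3.eventually (lt_mem_nhds h4)] with n hn _ using hn.le
        filter_upwards [this] with n hn
        exact lb_h (hrp _) hM ((bh _).trans (by linarith)) hn
      have := (weak_TT' wK (fun n => hKpsupp _) hKsupp (fun n => hKpint _)
        (fun n => (hbdd _).1) hK2 (lt_min one_pos (div_pos hδp hM)) th hev).2
      refine tendsto_nhds_unique tk (this.congr fun n => ?_)
      exact (eqs (hsp _)).2.symm
    obtain ⟨u1, u2⟩ := sol_unique hz rh' hr hRsupp hR2 hKsupp hK2 hR0 eh' ek' eh ek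
    rw [← u1, ← u2]
    exact ht
  exact ⟨(continuous_fst.tendsto _).comp main, (continuous_snd.tendsto _).comp main⟩
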